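/- arXiv:1506.08155 — 3 statements merged into one kernel-verified Lean document; each statement's English description precedes it below -/
import Mathlib

section
/- For every constant c > 0, the function h(μ) := G(−μ², c²μ²) is strictly decreasing on (0, ∞); equivalently, for all μ > 0, E[min(1, exp(−μ² + cμZ))] with Z ~ N(0,1) is strictly decreasing in μ. -/
open MeasureTheory ProbabilityTheory Real Filter Set
open scoped Topology

/-- The Metropolis–Hastings accept-reject function `F(u) = min(1, eᵘ)`. -/
noncomputable def Facc (u : ℝ) : ℝ := min 1 (Real.exp u)

/-- The law of the limiting bivariate Gaussian pair `(Q∞, S∞)` with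
`Q∞ ~ N(−μ²/2, μ²)`, `S∞ ~ N(β₁μ²/2, β₂²μ²)` and `Cov(Q∞, S∞) = −β₁μ²`
(valid whenever `|β₁| ≤ β₂`), realised as the image of two independent
standard Gaussians. -/
noncomputable def QSmeas (μ β₁ β₂ : ℝ) : Measure (ℝ × ℝ) :=
  Measure.map
    (fun z : ℝ × ℝ =>
      (-μ ^ 2 / 2 + μ * z.1,
        β₁ * μ ^ 2 / 2 + μ * (-(β₁ * z.1) + Real.sqrt (β₂ ^ 2 - β₁ ^ 2) * z.2)))
    ((gaussianReal 0 1).prod (gaussianReal 0 1))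

/-- Law of `W_Δ = W* − W ~ N(−σ², 2σ²)` under the Gaussian noise assumption. -/
noncomputable def gaussNoise (σ : ℝ) : Measure ℝ :=
  gaussianReal (-σ ^ 2) (Real.toNNReal (2 * σ ^ 2))

/-- Limiting Stage One acceptance rate `α₁(μ; β₁, β₂) = E[F(Q∞ + S∞)]`. -/
noncomputable def alpha1 (μ β₁ β₂ : ℝ) : ℝ :=
  ∫ p : ℝ × ℝ, Facc (p.1 + p.2) ∂(QSmeas μ β₁ β₂)

/-- Limiting overall acceptance rate `α₁₂(μ, σ; β₁, β₂) = E[F(Q∞ + S∞)·F(W_Δ − S∞)]`. -/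
noncomputable def alpha12 (μ σ β₁ β₂ : ℝ) : ℝ :=
  ∫ p : (ℝ × ℝ) × ℝ, Facc (p.1.1 + p.1.2) * Facc (p.2 - p.1.2)
    ∂((QSmeas μ β₁ β₂).prod (gaussNoise σ))

/-- Standard normal cumulative distribution function `Φ`. -/
noncomputable def stdPhi (x : ℝ) : ℝ := ((gaussianReal 0 1) (Set.Iic x)).toReal

/-- `G(m, v) = E[min(1, e^N)]` for `N ~ N(m, v)`; for `v > 0` this is
`Φ(m/√v) + e^{m + v/2} Φ(−√v − m/√v)`, and `G(m, 0) = min(1, e^m)`. -/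
noncomputable def Gfun (m v : ℝ) : ℝ :=
  if v = 0 then min 1 (Real.exp m)
  else stdPhi (m / Real.sqrt v) + Real.exp (m + v / 2) * stdPhi (-Real.sqrt v - m / Real.sqrt v)

lemma gaussianPDFReal_zero_one_neg (x : ℝ) :
    gaussianPDFReal 0 1 (-x) = gaussianPDFReal 0 1 x := by
  simp [gaussianPDFReal]

lemma hasDerivAt_gaussianPDFReal_zero_one (x : ℝ) :
    HasDerivAt (gaussianPDFReal 0 1) (-x * gaussianPDFReal 0 1 x) x := by
  have h : HasDerivAt (fun t : ℝ => -t ^ 2 / 2) (-x) x := by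
    refine (((hasDerivAt_pow 2 x).neg).div_const 2).congr_deriv ?_
    norm_num
    ring
  have he : gaussianPDFReal 0 1 = fun t : ℝ => (√(2 * π))⁻¹ * Real.exp (-t ^ 2 / 2) := by
    ext t
    simp [gaussianPDFReal]
  rw [he]
  exact (h.exp.const_mul (√(2 * π))⁻¹).congr_deriv (by ring)

lemma stdPhi_eq_integral (x : ℝ) : stdPhi x = ∫ t in Iic x, gaussianPDFReal 0 1 t := by
  rw [stdPhi, gaussianReal_apply_eq_integral 0 one_ne_zero, ENNReal.toReal_ofReal]
  exact integral_nonneg fun t => gaussianPDFReal_nonneg 0 1 t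

lemma stdPhi_nonneg (x : ℝ) : 0 ≤ stdPhi x := ENNReal.toReal_nonneg

lemma hasDerivAt_stdPhi (x : ℝ) : HasDerivAt stdPhi (gaussianPDFReal 0 1 x) x := by
  have hint := integrable_gaussianPDFReal 0 1
  have hcont : Continuous (gaussianPDFReal 0 1) :=
    continuous_iff_continuousAt.2 fun t => (hasDerivAt_gaussianPDFReal_zero_one t).continuousAt
  have he : stdPhi = fun u => stdPhi 0 + ∫ t in (0 : ℝ)..u, gaussianPDFReal 0 1 t := by
    ext u
    rw [← intervalIntegral.integral_Iic_sub_Iic hint.integrableOn hint.integrableOn,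
      stdPhi_eq_integral, stdPhi_eq_integral]
    ring
  rw [he]
  exact (intervalIntegral.integral_hasDerivAt_right (hcont.intervalIntegrable 0 x)
    (hcont.stronglyMeasurableAtFilter _ _) hcont.continuousAt).const_add _

/-- The Mills ratio bound `x Φ(-x) ≤ φ(x)`. -/
lemma mul_stdPhi_neg_le (x : ℝ) : x * stdPhi (-x) ≤ gaussianPDFReal 0 1 x := by
  have hint := integrable_gaussianPDFReal 0 1
  have hint' : Integrable fun t : ℝ => -t * gaussianPDFReal 0 1 t := by
    have h := (integrable_mul_exp_neg_mul_sq (b := 1 / 2) (by norm_num)).const_mul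
      (-(√(2 * π))⁻¹)
    refine h.congr (Eventually.of_forall fun t => ?_)
    have ht : -(1 / 2) * t ^ 2 = -t ^ 2 / 2 := by ring
    simp only [gaussianPDFReal, sub_zero, NNReal.coe_one, mul_one, ht]
    ring
  have hlim := tendsto_zero_of_hasDerivAt_of_integrableOn_Iic (a := -x)
    (fun t _ => hasDerivAt_gaussianPDFReal_zero_one t) hint'.integrableOn hint.integrableOn
  have hval := integral_Iic_of_hasDerivAt_of_tendsto' (a := -x)
    (fun t _ => hasDerivAt_gaussianPDFReal_zero_one t) hint'.integrableOn hlim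
  rw [sub_zero, gaussianPDFReal_zero_one_neg] at hval
  rw [← hval, stdPhi_eq_integral, ← integral_const_mul]
  refine setIntegral_mono_on (hint.const_mul x).integrableOn hint'.integrableOn
    measurableSet_Iic fun t ht => ?_
  exact mul_le_mul_of_nonneg_right (by linarith [mem_Iic.1 ht]) (gaussianPDFReal_nonneg 0 1 t)

lemma Gfun_neg_sq_eq {c μ : ℝ} (hc : 0 < c) (hμ : 0 < μ) :
    Gfun (-μ ^ 2) (c ^ 2 * μ ^ 2) =
      stdPhi (-(1 / c) * μ) + Real.exp ((c ^ 2 / 2 - 1) * μ ^ 2) * stdPhi (-(c - 1 / c) * μ) := by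
  have hs : √(c ^ 2 * μ ^ 2) = c * μ := by
    rw [← mul_pow, Real.sqrt_sq (by positivity)]
  have hv : c ^ 2 * μ ^ 2 ≠ 0 := by positivity
  rw [Gfun, if_neg hv, hs]
  congr 2
  · field_simp
  · congr 1
    ring
  · congr 1
    field_simp
    ring

lemma exp_mul_gaussianPDFReal {c : ℝ} (hc : c ≠ 0) (x : ℝ) :
    Real.exp ((c ^ 2 / 2 - 1) * x ^ 2) * gaussianPDFReal 0 1 (-(c - 1 / c) * x) =
      gaussianPDFReal 0 1 (-(1 / c) * x) := by
  simp only [gaussianPDFReal, sub_zero, NNReal.coe_one, mul_one]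
  rw [mul_left_comm, ← Real.exp_add]
  congr 2
  field_simp
  ring

/-- The derivative of `x ↦ G(-x², c²x²)`, in closed form. -/
lemma hasDerivAt_stdPhi_add_exp_mul {c : ℝ} (hc : c ≠ 0) (x : ℝ) :
    HasDerivAt
      (fun y => stdPhi (-(1 / c) * y) +
        Real.exp ((c ^ 2 / 2 - 1) * y ^ 2) * stdPhi (-(c - 1 / c) * y))
      ((c ^ 2 - 2) * x * (Real.exp ((c ^ 2 / 2 - 1) * x ^ 2) * stdPhi (-(c - 1 / c) * x)) -
        c * gaussianPDFReal 0 1 (-(1 / c) * x)) x := by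
  have hlin (k : ℝ) : HasDerivAt (fun y => stdPhi (k * y)) (gaussianPDFReal 0 1 (k * x) * k) x :=
    (hasDerivAt_stdPhi (k * x)).comp x (by simpa using (hasDerivAt_id x).const_mul k)
  have hexp := ((hasDerivAt_pow 2 x).const_mul (c ^ 2 / 2 - 1)).exp
  refine ((hlin (-(1 / c))).add (hexp.mul (hlin (-(c - 1 / c))))).congr_deriv ?_
  rw [← exp_mul_gaussianPDFReal hc x]
  push_cast
  field_simp
  ring

lemma stdPhi_add_exp_mul_deriv_neg {c x : ℝ} (hc : 0 < c) (hx : 0 < x) :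
    (c ^ 2 - 2) * x * (Real.exp ((c ^ 2 / 2 - 1) * x ^ 2) * stdPhi (-(c - 1 / c) * x)) -
      c * gaussianPDFReal 0 1 (-(1 / c) * x) < 0 := by
  set E := Real.exp ((c ^ 2 / 2 - 1) * x ^ 2) with hE
  set P := stdPhi (-(c - 1 / c) * x) with hP
  set p := gaussianPDFReal 0 1 (-(1 / c) * x) with hp
  have hEP : 0 ≤ E * P := mul_nonneg (Real.exp_pos _).le (stdPhi_nonneg _)
  have hp0 : 0 < p := gaussianPDFReal_pos 0 1 _ one_ne_zero
  rcases le_or_gt (c ^ 2) 2 with h | h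
  · have : (c ^ 2 - 2) * x * (E * P) ≤ 0 :=
      mul_nonpos_of_nonpos_of_nonneg (mul_nonpos_of_nonpos_of_nonneg (by linarith) hx.le) hEP
    nlinarith [mul_pos hc hp0]
  · have hmills : (c - 1 / c) * x * (E * P) ≤ p := by
      have h1 := mul_le_mul_of_nonneg_left (mul_stdPhi_neg_le ((c - 1 / c) * x))
        (Real.exp_pos ((c ^ 2 / 2 - 1) * x ^ 2)).le
      rw [← gaussianPDFReal_zero_one_neg ((c - 1 / c) * x), ← neg_mul,
        exp_mul_gaussianPDFReal hc.ne' x, ← hE, ← hP, ← hp] at h1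
      linarith
    have hscaled : (c ^ 2 - 1) * (x * (E * P)) ≤ c * p := by
      have h1 := mul_le_mul_of_nonneg_left hmills hc.le
      have h2 : c * ((c - 1 / c) * x * (E * P)) = (c ^ 2 - 1) * (x * (E * P)) := by
        field_simp
      linarith
    have hcp := mul_pos hc hp0
    rcases (mul_nonneg hx.le hEP).eq_or_lt with h0 | h0
    · rw [mul_assoc, ← h0]
      linarith
    · linarith

/-- for every constant `c > 0`, the function `h(μ) = G(−μ², c²μ²)`,
i.e. `E[min(1, exp(−μ² + cμZ))]` for `Z ~ N(0,1)`, is strictly decreasing on `(0, ∞)`. -/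
theorem stmt7 (c : ℝ) (hc : 0 < c) :
    StrictAntiOn (fun μ : ℝ => Gfun (-μ ^ 2) (c ^ 2 * μ ^ 2)) (Set.Ioi 0) := by
  have hanti : StrictAntiOn (fun y => stdPhi (-(1 / c) * y) +
      Real.exp ((c ^ 2 / 2 - 1) * y ^ 2) * stdPhi (-(c - 1 / c) * y)) (Set.Ioi 0) := by
    refine strictAntiOn_of_deriv_neg (convex_Ioi 0)
      (fun x _ => (hasDerivAt_stdPhi_add_exp_mul hc.ne' x).continuousAt.continuousWithinAt)
      fun x hx => ?_
    rw [interior_Ioi] at hx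
    rw [(hasDerivAt_stdPhi_add_exp_mul hc.ne' x).deriv]
    exact stdPhi_add_exp_mul_deriv_neg hc hx
  exact hanti.congr fun x hx => (Gfun_neg_sq_eq hc hx).symm
end

section
/- Fix β₂ > 0, β₁ ∈ ℝ with |β₁| ≤ β₂ and β₁ < 1, and η > 0. For every fixed σ² > 0, the efficiency functional satisfies Eff(μ, σ²) → 0 as μ → 0⁺ and Eff(μ, σ²) → 0 as μ → ∞. -/
open MeasureTheory ProbabilityTheory Real Filter Set
open scoped Topology

/-- The efficiency functional `Eff(μ, σ²) = μ² σ² α₁₂(μ, σ) / (η σ² + α₁(μ))`,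
written as a function of `v = σ²`. -/
noncomputable def Eff (η μ β₁ β₂ v : ℝ) : ℝ :=
  μ ^ 2 * v * alpha12 μ (Real.sqrt v) β₁ β₂ / (η * v + alpha1 μ β₁ β₂)

lemma Facc_nonneg (u : ℝ) : 0 ≤ Facc u := le_min zero_le_one (Real.exp_pos u).le

lemma Facc_le_one (u : ℝ) : Facc u ≤ 1 := min_le_left _ _

lemma Facc_le_exp_mul {t : ℝ} (ht0 : 0 ≤ t) (ht1 : t ≤ 1) (u : ℝ) :
    Facc u ≤ Real.exp (t * u) := by
  rcases le_total 0 u with hu | hu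
  · exact (Facc_le_one u).trans (Real.one_le_exp (mul_nonneg ht0 hu))
  · exact (min_le_right _ _).trans (Real.exp_le_exp.2 (by nlinarith))

lemma QSmeas_map_measurable (μ β₁ β₂ : ℝ) : Measurable (fun z : ℝ × ℝ =>
      (-μ ^ 2 / 2 + μ * z.1,
        β₁ * μ ^ 2 / 2 + μ * (-(β₁ * z.1) + Real.sqrt (β₂ ^ 2 - β₁ ^ 2) * z.2))) := by
  fun_prop

instance isProbabilityMeasure_QSmeas (μ β₁ β₂ : ℝ) : IsProbabilityMeasure (QSmeas μ β₁ β₂) :=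
  Measure.isProbabilityMeasure_map (QSmeas_map_measurable μ β₁ β₂).aemeasurable

instance isProbabilityMeasure_gaussNoise (σ : ℝ) : IsProbabilityMeasure (gaussNoise σ) := by
  unfold gaussNoise
  infer_instance

lemma integral_exp_mul_stdGaussian (a : ℝ) :
    ∫ x, Real.exp (a * x) ∂(gaussianReal 0 1) = Real.exp (a ^ 2 / 2) := by
  have h := congrFun (mgf_id_gaussianReal (μ := 0) (v := 1)) a
  simpa [mgf] using h

/-- The moment generating function of `Q∞ + S∞`, with integrability. -/
lemma integrable_integral_exp_QSmeas {β₁ β₂ : ℝ} (hβ : |β₁| ≤ β₂) (μ t : ℝ) :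
    Integrable (fun p : ℝ × ℝ => Real.exp (t * (p.1 + p.2))) (QSmeas μ β₁ β₂) ∧
    ∫ p : ℝ × ℝ, Real.exp (t * (p.1 + p.2)) ∂(QSmeas μ β₁ β₂) =
      Real.exp ((-(t * (1 - β₁)) + t ^ 2 * ((1 - β₁) ^ 2 + (β₂ ^ 2 - β₁ ^ 2))) * (μ ^ 2 / 2)) := by
  have hr : 0 ≤ β₂ ^ 2 - β₁ ^ 2 := sub_nonneg.2 (sq_le_sq.2 (hβ.trans (le_abs_self β₂)))
  have hm := QSmeas_map_measurable μ β₁ β₂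
  have hc : AEStronglyMeasurable (fun p : ℝ × ℝ => Real.exp (t * (p.1 + p.2)))
      (QSmeas μ β₁ β₂) := by fun_prop
  set r := Real.sqrt (β₂ ^ 2 - β₁ ^ 2) with hr_def
  have hr2 : r ^ 2 = β₂ ^ 2 - β₁ ^ 2 := Real.sq_sqrt hr
  have heq : ∀ z : ℝ × ℝ,
      Real.exp (t * ((-μ ^ 2 / 2 + μ * z.1) + (β₁ * μ ^ 2 / 2 + μ * (-(β₁ * z.1) + r * z.2)))) =
        Real.exp (-(t * (1 - β₁)) * (μ ^ 2 / 2)) *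
          (Real.exp (t * μ * (1 - β₁) * z.1) * Real.exp (t * μ * r * z.2)) := by
    intro z
    rw [← Real.exp_add, ← Real.exp_add]
    congr 1
    ring
  have hint (a : ℝ) : Integrable (fun x => Real.exp (a * x)) (gaussianReal 0 1) :=
    integrable_exp_mul_gaussianReal a
  unfold QSmeas at hc ⊢
  rw [integrable_map_measure hc hm.aemeasurable, integral_map hm.aemeasurable hc]
  simp only [Function.comp_def, ← hr_def, heq]
  refine ⟨((hint _).mul_prod (hint _)).const_mul _, ?_⟩
  rw [integral_const_mul, integral_prod_mul (fun x => Real.exp (t * μ * (1 - β₁) * x))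
    (fun x => Real.exp (t * μ * r * x)), integral_exp_mul_stdGaussian,
    integral_exp_mul_stdGaussian, ← Real.exp_add, ← Real.exp_add, ← hr2]
  congr 1
  ring

lemma alpha1_nonneg (μ β₁ β₂ : ℝ) : 0 ≤ alpha1 μ β₁ β₂ :=
  integral_nonneg fun _ => Facc_nonneg _

lemma alpha12_nonneg (μ σ β₁ β₂ : ℝ) : 0 ≤ alpha12 μ σ β₁ β₂ :=
  integral_nonneg fun _ => mul_nonneg (Facc_nonneg _) (Facc_nonneg _)

/-- Chernoff bound for the overall acceptance rate. -/
lemma alpha12_le {β₁ β₂ : ℝ} (hβ : |β₁| ≤ β₂) {t : ℝ} (ht0 : 0 ≤ t) (ht1 : t ≤ 1) (μ σ : ℝ) :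
    alpha12 μ σ β₁ β₂ ≤
      Real.exp ((-(t * (1 - β₁)) + t ^ 2 * ((1 - β₁) ^ 2 + (β₂ ^ 2 - β₁ ^ 2))) * (μ ^ 2 / 2)) := by
  obtain ⟨hi, he⟩ := integrable_integral_exp_QSmeas hβ μ t
  calc alpha12 μ σ β₁ β₂
      ≤ ∫ p : (ℝ × ℝ) × ℝ, Real.exp (t * (p.1.1 + p.1.2))
          ∂((QSmeas μ β₁ β₂).prod (gaussNoise σ)) := by
        refine integral_mono_of_nonneg (ae_of_all _ fun _ =>
          mul_nonneg (Facc_nonneg _) (Facc_nonneg _)) (hi.comp_fst _) (ae_of_all _ fun p => ?_)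
        exact (mul_le_of_le_one_right (Facc_nonneg _) (Facc_le_one _)).trans
          (Facc_le_exp_mul ht0 ht1 _)
    _ = _ := by
        rw [integral_fun_fst (fun p : ℝ × ℝ => Real.exp (t * (p.1 + p.2))), he]
        simp

lemma Eff_nonneg {η v : ℝ} (hη : 0 < η) (hv : 0 < v) (μ β₁ β₂ : ℝ) : 0 ≤ Eff η μ β₁ β₂ v :=
  div_nonneg (mul_nonneg (by positivity) (alpha12_nonneg _ _ _ _))
    (add_nonneg (by positivity) (alpha1_nonneg _ _ _))

lemma Eff_le {η v : ℝ} (hη : 0 < η) (hv : 0 < v) (μ β₁ β₂ : ℝ) :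
    Eff η μ β₁ β₂ v ≤ μ ^ 2 * alpha12 μ (Real.sqrt v) β₁ β₂ / η := by
  have h0 := alpha12_nonneg μ (Real.sqrt v) β₁ β₂
  calc Eff η μ β₁ β₂ v
      ≤ μ ^ 2 * v * alpha12 μ (Real.sqrt v) β₁ β₂ / (η * v) :=
        div_le_div_of_nonneg_left (by positivity) (by positivity)
          (le_add_of_nonneg_right (alpha1_nonneg _ _ _))
    _ = _ := by field_simp

/-- A Chernoff exponent for which the moment generating function of `Q∞ + S∞` decays. -/
lemma exists_chernoff_exponent {a b : ℝ} (ha : 0 < a) (hb : 0 ≤ b) :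
    ∃ t : ℝ, 0 ≤ t ∧ t ≤ 1 ∧ -(t * a) + t ^ 2 * b < 0 := by
  refine ⟨a / (a + b + a), by positivity, (div_le_one (by positivity)).2 (by linarith), ?_⟩
  set t := a / (a + b + a) with ht
  have htp : 0 < t := by positivity
  have h1 : t * (a + b + a) = a := div_mul_cancel₀ _ (by positivity)
  nlinarith [mul_pos htp (mul_pos htp ha)]

/-- for fixed `β₂ > 0`, `|β₁| ≤ β₂`, `β₁ < 1`, `η > 0` and every fixed
`σ² > 0`, the efficiency `Eff(μ, σ²) → 0` both as `μ → 0⁺` and as `μ → ∞`. -/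
theorem stmt13 (β₁ β₂ η : ℝ) (hβ₂ : 0 < β₂) (hβ : |β₁| ≤ β₂) (hβ₁ : β₁ < 1) (hη : 0 < η)
    (v : ℝ) (hv : 0 < v) :
    Tendsto (fun μ : ℝ => Eff η μ β₁ β₂ v) (nhdsWithin 0 (Set.Ioi 0)) (nhds 0) ∧
      Tendsto (fun μ : ℝ => Eff η μ β₁ β₂ v) atTop (nhds 0) := by
  have hb : 0 ≤ (1 - β₁) ^ 2 + (β₂ ^ 2 - β₁ ^ 2) :=
    add_nonneg (sq_nonneg _) (sub_nonneg.2 (sq_le_sq.2 (hβ.trans (le_abs_self β₂))))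
  constructor
  · have hlim : Tendsto (fun μ : ℝ => μ ^ 2 / η) (𝓝[>] 0) (𝓝 0) := by
      have h : Continuous fun μ : ℝ => μ ^ 2 / η := by fun_prop
      simpa using (h.tendsto 0).mono_left nhdsWithin_le_nhds
    refine squeeze_zero (fun μ => Eff_nonneg hη hv μ β₁ β₂) (fun μ => ?_) hlim
    refine (Eff_le hη hv μ β₁ β₂).trans ?_
    have h1 : alpha12 μ (Real.sqrt v) β₁ β₂ ≤ 1 := by
      simpa using alpha12_le hβ le_rfl zero_le_one μ (Real.sqrt v)
    gcongr
    exact mul_le_of_le_one_right (sq_nonneg μ) h1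
  · obtain ⟨t, ht0, ht1, ht⟩ := exists_chernoff_exponent (sub_pos.2 hβ₁) hb
    set c := -(t * (1 - β₁)) + t ^ 2 * ((1 - β₁) ^ 2 + (β₂ ^ 2 - β₁ ^ 2)) with hc
    have hlim : Tendsto (fun μ : ℝ => μ ^ 2 * Real.exp (c * (μ ^ 2 / 2)) / η) atTop (𝓝 0) := by
      have h := (tendsto_rpow_mul_exp_neg_mul_atTop_nhds_zero 1 (-c / 2)
        (by linarith)).comp (tendsto_pow_atTop (α := ℝ) two_ne_zero)
      have h' := h.div_const η
      rw [zero_div] at h'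
      refine h'.congr fun μ => ?_
      simp only [Function.comp_apply, Real.rpow_one]
      congr 3
      ring
    refine squeeze_zero (fun μ => Eff_nonneg hη hv μ β₁ β₂) (fun μ => ?_) hlim
    refine (Eff_le hη hv μ β₁ β₂).trans ?_
    gcongr
    exact alpha12_le hβ ht0 ht1 μ (Real.sqrt v)
end

section
/- For all μ > 0, σ > 0 and all β₁, β₂ with β₂ > 0 and |β₁| ≤ β₂, the limiting overall acceptance rate satisfies α₁₂(μ, σ) ≤ 2 Φ( −√(μ² + 2σ²)/2 ), where Φ is the standard normal CDF. -/
open MeasureTheory ProbabilityTheory Real Filter Set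
open scoped Topology

@[fun_prop]
lemma continuous_Facc : Continuous Facc := continuous_const.min continuous_exp

lemma Facc_mul_Facc_le (a b : ℝ) : Facc a * Facc b ≤ Facc (a + b) := by
  refine le_min (mul_le_one₀ (Facc_le_one a) (Facc_nonneg b) (Facc_le_one b)) ?_
  rw [exp_add]
  exact mul_le_mul (min_le_right _ _) (min_le_right _ _) (Facc_nonneg b) (exp_pos a).le

lemma integrable_Facc_comp {α : Type*} [MeasurableSpace α] {P : Measure α} [IsFiniteMeasure P]
    {f : α → ℝ} (hf : Measurable f) : Integrable (fun x ↦ Facc (f x)) P :=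
  .of_bound (continuous_Facc.measurable.comp hf).aestronglyMeasurable 1 <| .of_forall fun x ↦ by
    simpa [abs_of_nonneg (Facc_nonneg _)] using Facc_le_one (f x)

/-- The first marginal of `QSmeas` is `N(-μ²/2, μ²)`. -/
lemma map_fst_QSmeas (μ β₁ β₂ : ℝ) :
    (QSmeas μ β₁ β₂).map Prod.fst = gaussianReal (-μ ^ 2 / 2) (Real.toNNReal (μ ^ 2)) := by
  have h : (fun z : ℝ × ℝ ↦ -μ ^ 2 / 2 + μ * z.1)
      = (fun x ↦ -μ ^ 2 / 2 + x) ∘ (fun x ↦ μ * x) ∘ Prod.fst := rfl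
  rw [QSmeas, Measure.map_map (by fun_prop) (by fun_prop)]
  change Measure.map (fun z : ℝ × ℝ ↦ -μ ^ 2 / 2 + μ * z.1) _ = _
  rw [h, ← Measure.map_map (by fun_prop) (by fun_prop),
    ← Measure.map_map (by fun_prop) (by fun_prop), Measure.map_fst_prod, measure_univ, one_smul,
    gaussianReal_map_const_mul, gaussianReal_map_const_add]
  congr 1
  · ring
  · ext
    simp [sq_nonneg]

lemma gaussianReal_map_sqrt (m : ℝ) {v : ℝ} (hv : 0 < v) :
    (gaussianReal 0 1).map (fun x ↦ m + √v * x) = gaussianReal m v.toNNReal := by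
  change (gaussianReal 0 1).map ((fun x ↦ m + x) ∘ (fun x ↦ √v * x)) = _
  rw [← Measure.map_map (by fun_prop) (by fun_prop), gaussianReal_map_const_mul,
    gaussianReal_map_const_add]
  congr 1
  · ring
  · ext
    simp [hv.le, Real.sq_sqrt]

lemma gaussianReal_real_Iic_zero {v : ℝ} (hv : 0 < v) :
    (gaussianReal (v / 2) v.toNNReal).real (Iic 0) = stdPhi (-√v / 2) := by
  rw [← gaussianReal_map_sqrt _ hv, stdPhi,
    map_measureReal_apply (by fun_prop) measurableSet_Iic, measureReal_def]
  congr 2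
  ext x
  have hs := Real.sqrt_pos.2 hv
  have h : v / 2 + √v * x = √v * (x - -√v / 2) := by
    nlinarith [Real.mul_self_sqrt hv.le]
  simp only [mem_preimage, mem_Iic, h]
  constructor
  · intro h
    by_contra! hx
    nlinarith [mul_pos hs (sub_pos.2 hx)]
  · intro hx
    exact mul_nonpos_of_nonneg_of_nonpos hs.le (sub_nonpos.2 hx)

lemma gaussianReal_real_Ioi_zero_le (m : ℝ) (v : NNReal) :
    (gaussianReal m v).real (Ioi 0) ≤ (gaussianReal (-m) v).real (Iic 0) := by
  rw [← gaussianReal_map_neg, map_measureReal_apply (by fun_prop) measurableSet_Iic]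
  exact measureReal_mono fun x hx ↦ by simpa using (mem_Ioi.1 hx).le

lemma gaussianPDFReal_neg_half_mul_exp {v : ℝ} (hv : 0 < v) (x : ℝ) :
    gaussianPDFReal (-(v / 2)) v.toNNReal x * rexp x = gaussianPDFReal (v / 2) v.toNNReal x := by
  simp only [gaussianPDFReal, Real.coe_toNNReal v hv.le]
  rw [mul_assoc, ← exp_add]
  congr 2
  field_simp
  ring

lemma setIntegral_gaussianPDFReal (m : ℝ) {v : NNReal} (hv : v ≠ 0) (s : Set ℝ) :
    ∫ x in s, gaussianPDFReal m v x = (gaussianReal m v).real s := by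
  rw [measureReal_def, gaussianReal_apply_eq_integral m hv,
    ENNReal.toReal_ofReal (integral_nonneg fun x ↦ gaussianPDFReal_nonneg m v x)]

lemma integral_Facc_gaussianReal_le {v : ℝ} (hv : 0 < v) :
    ∫ x, Facc x ∂gaussianReal (-(v / 2)) v.toNNReal ≤ 2 * stdPhi (-√v / 2) := by
  have hv' : v.toNNReal ≠ 0 := (Real.toNNReal_pos.2 hv).ne'
  set p := gaussianPDFReal (-(v / 2)) v.toNNReal
  have hint : Integrable (fun x ↦ p x * Facc x) :=
    (integrable_gaussianPDFReal _ _).mul_bdd (c := 1)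
      continuous_Facc.aestronglyMeasurable <| .of_forall fun x ↦ by
      simpa [abs_of_nonneg (Facc_nonneg _)] using Facc_le_one x
  have hle : ∫ x in Iic 0, p x * Facc x = stdPhi (-√v / 2) := by
    rw [← gaussianReal_real_Iic_zero hv, ← setIntegral_gaussianPDFReal _ hv']
    refine setIntegral_congr_fun measurableSet_Iic fun x hx ↦ ?_
    simp only [Facc, min_eq_right (exp_le_one_iff.2 (mem_Iic.1 hx))]
    exact gaussianPDFReal_neg_half_mul_exp hv x
  have hgt : ∫ x in Ioi 0, p x * Facc x ≤ stdPhi (-√v / 2) := by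
    rw [setIntegral_congr_fun (g := p) measurableSet_Ioi fun x hx ↦ by
      simp only [Facc, min_eq_left (one_le_exp (mem_Ioi.1 hx).le), mul_one],
      setIntegral_gaussianPDFReal _ hv', ← gaussianReal_real_Iic_zero hv]
    simpa using gaussianReal_real_Ioi_zero_le (-(v / 2)) v.toNNReal
  rw [integral_gaussianReal_eq_integral_smul hv']
  simp only [smul_eq_mul]
  rw [← integral_add_compl measurableSet_Iic hint, compl_Iic, hle, two_mul]
  gcongr

/-- for all `μ > 0`, `σ > 0` and `β₁, β₂` with `β₂ > 0` and `|β₁| ≤ β₂`,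
the limiting overall acceptance rate satisfies `α₁₂(μ, σ) ≤ 2 Φ(−√(μ² + 2σ²)/2)`. -/
theorem stmt16 (μ σ β₁ β₂ : ℝ) (hμ : 0 < μ) (hσ : 0 < σ) (hβ₂ : 0 < β₂) (hβ : |β₁| ≤ β₂) :
    alpha12 μ σ β₁ β₂ ≤ 2 * stdPhi (-(Real.sqrt (μ ^ 2 + 2 * σ ^ 2)) / 2) := by
  have : IsProbabilityMeasure (QSmeas μ β₁ β₂) :=
    Measure.isProbabilityMeasure_map (by fun_prop)
  have : IsProbabilityMeasure (gaussNoise σ) := by unfold gaussNoise; infer_instance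
  set P := (QSmeas μ β₁ β₂).prod (gaussNoise σ)
  have hlaw : P.map (fun p ↦ p.1.1 + p.2)
      = gaussianReal (-((μ ^ 2 + 2 * σ ^ 2) / 2)) (μ ^ 2 + 2 * σ ^ 2).toNNReal := by
    have h : (fun p : (ℝ × ℝ) × ℝ ↦ p.1.1 + p.2)
        = (fun q : ℝ × ℝ ↦ q.1 + q.2) ∘ Prod.map Prod.fst id := rfl
    rw [h, ← Measure.map_map (by fun_prop) (by fun_prop),
      ← Measure.map_prod_map _ _ measurable_fst measurable_id, map_fst_QSmeas, Measure.map_id,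
      gaussNoise, ← Measure.conv, gaussianReal_conv_gaussianReal,
      Real.toNNReal_add (by positivity) (by positivity)]
    congr 1
    ring
  calc alpha12 μ σ β₁ β₂ ≤ ∫ p, Facc (p.1.1 + p.2) ∂P := by
        refine integral_mono_of_nonneg
          (.of_forall fun p ↦ mul_nonneg (Facc_nonneg _) (Facc_nonneg _))
          (integrable_Facc_comp (by fun_prop)) (.of_forall fun p ↦ ?_)
        exact (Facc_mul_Facc_le _ _).trans_eq (by ring_nf)
    _ = ∫ x, Facc x ∂P.map (fun p ↦ p.1.1 + p.2) :=
        (integral_map (by fun_prop) continuous_Facc.aestronglyMeasurable).symm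
    _ ≤ 2 * stdPhi (-√(μ ^ 2 + 2 * σ ^ 2) / 2) := by
        rw [hlaw]
        exact integral_Facc_gaussianReal_le (by positivity)
end
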